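/- arXiv:2401.03893 — 2 statements merged into one kernel-verified Lean document; each statement's English description precedes it below -/
import Mathlib

section
/- Suppose Assumptions 1–4 below hold (with δ_H ∈ [0,1]), the noise satisfies the second-moment martingale-difference condition, and the step sizes satisfy the appendix step-size assumption. If in addition ∑_{t=1}^∞ β_t = ∞, ∑_{t=1}^∞ α_t² < ∞, and ∑_{t=1}^∞ β_t^{2+2δ_H}/α_t < ∞, then x̂_t = x_t − H(y_t) → 0 almost surely and ŷ_t = y_t − y⋆ → 0 almost surely as t → ∞. -/
set_option autoImplicit false

open MeasureTheory Filter
open scoped RealInnerProductSpace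

noncomputable section

/-- Spectral norm of a rectangular real matrix (the operator norm of the induced
linear map between Euclidean spaces). -/
def specNorm {m n : ℕ} (A : Matrix (Fin m) (Fin n) ℝ) : ℝ :=
  ‖LinearMap.toContinuousLinearMap (Matrix.toEuclideanLin A)‖

/-- The σ-algebra `𝔉 t = σ(x₀, y₀, ξ₀, ψ₀, …, ξ_{t-1}, ψ_{t-1})`. -/
def natFilt {Ω : Type} [MeasurableSpace Ω] {dx dy : ℕ}
    (x0 : Ω → EuclideanSpace ℝ (Fin dx)) (y0 : Ω → EuclideanSpace ℝ (Fin dy))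
    (ξ : ℕ → Ω → EuclideanSpace ℝ (Fin dx)) (ψ : ℕ → Ω → EuclideanSpace ℝ (Fin dy))
    (t : ℕ) : MeasurableSpace Ω :=
  MeasurableSpace.comap x0 inferInstance ⊔ MeasurableSpace.comap y0 inferInstance ⊔
    ⨆ s ∈ Finset.range t,
      (MeasurableSpace.comap (ξ s) inferInstance ⊔ MeasurableSpace.comap (ψ s) inferInstance)

/-- A nonnegative supermartingale-type convergence theorem (Robbins–Siegmund), with a
deterministic contraction rate whose sum diverges. -/
theorem ae_tendsto_zero_of_condExp_le {Ω : Type*} {m0 : MeasurableSpace Ω} {μ : Measure Ω}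
    [IsProbabilityMeasure μ] {ℱ : Filtration ℕ m0} {V : ℕ → Ω → ℝ} {η b z : ℕ → ℝ}
    (hVadp : StronglyAdapted ℱ V) (hVint : ∀ t, Integrable (V t) μ) (hV : ∀ t ω, 0 ≤ V t ω)
    (hη : ∀ t, 0 ≤ η t) (hηsum : Summable η) (hb : ∀ t, 0 ≤ b t) (hbsum : ¬ Summable b)
    (hz : ∀ t, 0 ≤ z t) (hzsum : Summable z)
    (hstep : ∀ t, μ[V (t + 1) | ℱ t] ≤ᵐ[μ] fun ω => (1 + η t - b t) * V t ω + z t) :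
    ∀ᵐ ω ∂μ, Tendsto (fun t => V t ω) atTop (nhds 0) := by
  set e : ℕ → ℝ := fun t => Real.exp (-∑ s ∈ Finset.range t, η s) with he
  have hepos : ∀ t, 0 < e t := fun t => Real.exp_pos _
  have hele : ∀ t, e t ≤ 1 := fun t =>
    Real.exp_le_one_iff.2 (neg_nonpos.2 (Finset.sum_nonneg fun s _ => hη s))
  have hestep : ∀ t, e (t + 1) * (1 + η t) ≤ e t := by
    intro t
    have h1 : e t = e (t + 1) * Real.exp (η t) := by
      simp only [he, Finset.sum_range_succ, ← Real.exp_add]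
      congr 1; ring
    rw [h1]
    exact mul_le_mul_of_nonneg_left (by linarith [Real.add_one_le_exp (η t)]) (hepos _).le
  have helim : Tendsto e atTop (nhds (Real.exp (-∑' s, η s))) :=
    (Real.continuous_exp.tendsto _).comp hηsum.hasSum.tendsto_sum_nat.neg
  set D : ℕ → Ω → ℝ := fun t ω => ∑ s ∈ Finset.range t, e (s + 1) * b s * V s ω with hD
  have hDnonneg : ∀ t ω, 0 ≤ D t ω := fun t ω => Finset.sum_nonneg fun s _ =>
    mul_nonneg (mul_nonneg (hepos _).le (hb s)) (hV s ω)
  set Z : ℕ → ℝ := fun t => ∑ s ∈ Finset.range t, z s with hZ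
  have hZle : ∀ t, Z t ≤ ∑' s, z s := fun t => hzsum.sum_le_tsum _ fun s _ => hz s
  set U : ℕ → Ω → ℝ := fun t ω => e t * V t ω + D t ω - Z t with hU
  have hDadp : ∀ t, StronglyMeasurable[ℱ t] (D (t + 1)) := by
    intro t
    refine Finset.stronglyMeasurable_fun_sum _ fun s hs => ?_
    exact ((hVadp s).mono (ℱ.mono (Nat.lt_succ_iff.1 (Finset.mem_range.1 hs)))).const_mul _
  have hDadp' : ∀ t, StronglyMeasurable[ℱ t] (D t) := by
    intro t
    refine Finset.stronglyMeasurable_fun_sum _ fun s hs => ?_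
    exact ((hVadp s).mono (ℱ.mono (Finset.mem_range.1 hs).le)).const_mul _
  have hDint : ∀ t, Integrable (D t) μ := fun t =>
    integrable_finsetSum _ fun s _ => (hVint s).const_mul _
  have hUint : ∀ t, Integrable (U t) μ := fun t =>
    (((hVint t).const_mul _).add (hDint t)).sub (integrable_const _)
  have hUsuper : Supermartingale U ℱ μ := by
    refine supermartingale_nat (fun t => ?_) hUint fun t => ?_
    · exact (((hVadp t).const_mul _).add (hDadp' t)).sub stronglyMeasurable_const
    · have hR : Integrable (fun ω => D (t + 1) ω - Z (t + 1)) μ :=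
        (hDint _).sub (integrable_const _)
      have hsplit : U (t + 1) = (e (t + 1) • V (t + 1)) + fun ω => D (t + 1) ω - Z (t + 1) := by
        ext ω; simp [hU]; ring
      have hc1 := condExp_add (m := ℱ t) ((hVint (t + 1)).smul (e (t + 1))) hR
      have hc2 := condExp_smul (μ := μ) (e (t + 1)) (V (t + 1)) (ℱ t)
      have hc3 := condExp_of_stronglyMeasurable (ℱ.le t)
        ((hDadp t).sub (stronglyMeasurable_const (b := Z (t + 1)))) hR
      rw [hsplit]
      filter_upwards [hc1, hc2, hstep t] with ω h1 h2 h3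
      rw [h1, Pi.add_apply, h2, Pi.smul_apply, smul_eq_mul]
      erw [hc3]
      simp only [hU, hD, hZ, Finset.sum_range_succ, Pi.sub_apply]
      have h4 := mul_le_mul_of_nonneg_left h3 (hepos (t + 1)).le
      have h5 := mul_le_mul_of_nonneg_right (hestep t) (hV t ω)
      have h6 := mul_le_mul_of_nonneg_right (hele (t + 1)) (hz t)
      nlinarith
  have hbdd : ∀ t, eLpNorm ((-U) t) 1 μ ≤
      ((∫ ω, U 0 ω ∂μ + 2 * ∑' s, z s).toNNReal : ENNReal) := by
    intro t
    have h0 : ∫ ω, U t ω ∂μ ≤ ∫ ω, U 0 ω ∂μ := by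
      simpa using hUsuper.setIntegral_le (Nat.zero_le t) MeasurableSet.univ
    have h1 : ∫ ω, ‖U t ω‖ ∂μ ≤ ∫ ω, U 0 ω ∂μ + 2 * ∑' s, z s := by
      have h2 : ∫ ω, ‖U t ω‖ ∂μ ≤ ∫ ω, (U t ω + 2 * ∑' s, z s) ∂μ := by
        refine integral_mono (hUint t).norm ((hUint t).add (integrable_const _)) fun ω => ?_
        have := mul_nonneg (hepos t).le (hV t ω)
        have := hDnonneg t ω
        have := hZle t
        have : 0 ≤ Z t := Finset.sum_nonneg fun s _ => hz s
        refine abs_le.2 ⟨?_, ?_⟩ <;> simp only [hU] <;> linarith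
      rw [integral_add (hUint t) (integrable_const _)] at h2
      simp only [integral_const, probReal_univ, one_smul] at h2
      linarith
    rw [Pi.neg_apply, eLpNorm_neg, eLpNorm_one_eq_lintegral_enorm,
      ← ofReal_integral_norm_eq_lintegral_enorm (hUint t)]
    exact ENNReal.ofReal_le_ofReal h1
  filter_upwards [hUsuper.neg.exists_ae_tendsto_of_bdd hbdd] with ω ⟨c, hc⟩
  have hUlim : Tendsto (fun t => U t ω) atTop (nhds (-c)) := by simpa using hc.neg
  have hZlim : Tendsto Z atTop (nhds (∑' s, z s)) := hzsum.hasSum.tendsto_sum_nat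
  have hsumlim : Tendsto (fun t => e t * V t ω + D t ω) atTop (nhds (-c + ∑' s, z s)) := by
    refine (hUlim.add hZlim).congr fun t => ?_
    simp [hU]
  obtain ⟨B, hB⟩ := hsumlim.bddAbove_range
  have hDsum : Summable fun s => e (s + 1) * b s * V s ω := by
    refine summable_of_sum_range_le
      (fun s => mul_nonneg (mul_nonneg (hepos _).le (hb s)) (hV s ω)) (c := B) fun t => ?_
    have h1 : e t * V t ω + D t ω ≤ B := hB ⟨t, rfl⟩
    have h2 := mul_nonneg (hepos t).le (hV t ω)
    change D t ω ≤ B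
    linarith
  have heVlim : Tendsto (fun t => e t * V t ω) atTop
      (nhds (-c + ∑' s, z s - ∑' s, e (s + 1) * b s * V s ω)) := by
    refine (hsumlim.sub hDsum.hasSum.tendsto_sum_nat).congr fun t => ?_
    simp [hD]
  set v := (-c + ∑' s, z s - ∑' s, e (s + 1) * b s * V s ω) / Real.exp (-∑' s, η s)
  have hVlim : Tendsto (fun t => V t ω) atTop (nhds v) :=
    (heVlim.div helim (Real.exp_pos _).ne').congr fun t => mul_div_cancel_left₀ _ (hepos t).ne'
  have hv : 0 ≤ v := ge_of_tendsto' hVlim fun t => hV t ω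
  rcases hv.eq_or_lt with h | h
  · rwa [h]
  refine absurd ?_ hbsum
  set δ := Real.exp (-∑' s, η s) * v
  have hδ : 0 < δ := mul_pos (Real.exp_pos _) h
  have hprod : Tendsto (fun t => e (t + 1) * V t ω) atTop (nhds δ) :=
    (helim.comp (tendsto_add_atTop_nat 1)).mul hVlim
  have hev : ∀ᶠ t in atTop, δ / 2 < e (t + 1) * V t ω :=
    hprod.eventually (lt_mem_nhds (half_lt_self hδ))
  refine Summable.of_norm_bounded_eventually_nat (hDsum.mul_left (2 / δ)) ?_
  filter_upwards [hev] with t ht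
  rw [Real.norm_of_nonneg (hb t)]
  have := mul_le_mul_of_nonneg_left ht.le (hb t)
  calc b t = 2 / δ * (b t * (δ / 2)) := by field_simp
    _ ≤ 2 / δ * (b t * (e (t + 1) * V t ω)) := by gcongr
    _ = 2 / δ * (e (t + 1) * b t * V t ω) := by ring

theorem tendsto_zero_of_mul_sq_norm_le {E : Type*} [NormedAddCommGroup E] {v : ℕ → E} {c : ℝ}
    {W : ℕ → ℝ} (hc : 0 < c) (hW : Tendsto W atTop (nhds 0)) (hle : ∀ t, c * ‖v t‖ ^ 2 ≤ W t) :
    Tendsto v atTop (nhds 0) := by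
  have h1 : Tendsto (fun t => W t / c) atTop (nhds 0) := by simpa using hW.div_const c
  have h2 : Tendsto (fun t => ‖v t‖ ^ 2) atTop (nhds 0) :=
    squeeze_zero (fun t => sq_nonneg _) (fun t => by
      rw [le_div_iff₀ hc, mul_comm]; exact hle t) h1
  have h3 := h2.sqrt
  simp only [Real.sqrt_sq (norm_nonneg _), Real.sqrt_zero] at h3
  exact tendsto_zero_iff_norm_tendsto_zero.2 h3

section OneStep

variable {E₁ E₂ : Type*} [NormedAddCommGroup E₁] [InnerProductSpace ℝ E₁]
  [NormedAddCommGroup E₂] [InnerProductSpace ℝ E₂]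

theorem sq_norm_add_four_le {E : Type*} [SeminormedAddCommGroup E] (a b c d : E) :
    ‖a + b + c + d‖ ^ 2 ≤ 4 * (‖a‖ ^ 2 + ‖b‖ ^ 2 + ‖c‖ ^ 2 + ‖d‖ ^ 2) := by
  have h : ‖a + b + c + d‖ ≤ ‖a‖ + ‖b‖ + ‖c‖ + ‖d‖ :=
    (norm_add_le _ _).trans (add_le_add_left (norm_add₃_le ..) _)
  refine (pow_le_pow_left₀ (norm_nonneg _) h 2).trans ?_
  nlinarith [sq_nonneg (‖a‖ - ‖b‖), sq_nonneg (‖a‖ - ‖c‖), sq_nonneg (‖a‖ - ‖d‖),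
    sq_nonneg (‖b‖ - ‖c‖), sq_nonneg (‖b‖ - ‖d‖), sq_nonneg (‖c‖ - ‖d‖)]

theorem sq_norm_fast_residual_le {H : E₂ → E₁} {LH LF muF alpha beta : ℝ}
    (halpha : 0 ≤ alpha) (hbeta : 0 ≤ beta)
    (hHlip : ∀ y₁ y₂, ‖H y₁ - H y₂‖ ≤ LH * ‖y₁ - y₂‖)
    (T : E₂ →L[ℝ] E₁) (x f n : E₁) (y g p : E₂)
    (hf : ‖f‖ ≤ LF * ‖x - H y‖) (hmono : muF * ‖x - H y‖ ^ 2 ≤ ⟪x - H y, f⟫) :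
    ‖x - alpha • (f + n) - H (y - beta • (g + p))‖ ^ 2 ≤
      (1 - 2 * muF * alpha + 4 * LF ^ 2 * alpha ^ 2) * ‖x - H y‖ ^ 2
        + 2 * LH * beta * ‖x - H y‖ * ‖g‖ + 4 * LH ^ 2 * beta ^ 2 * ‖g‖ ^ 2
        + 2 * ‖x - H y‖ * ‖H (y - beta • g) - H (y - beta • (g + p)) - T (beta • p)‖
        - 2 * alpha * ⟪x - H y, n⟫ + 2 * beta * ⟪x - H y, T p⟫
        + 4 * alpha ^ 2 * ‖n‖ ^ 2 + 4 * LH ^ 2 * beta ^ 2 * ‖p‖ ^ 2 := by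
  set u := x - H y
  set r := H (y - beta • g) - H (y - beta • (g + p)) - T (beta • p) with hr
  have hdrift : ‖H y - H (y - beta • g)‖ ≤ LH * (beta * ‖g‖) := by
    simpa [norm_smul, abs_of_nonneg hbeta] using hHlip y (y - beta • g)
  have hnoise : ‖H (y - beta • g) - H (y - beta • (g + p))‖ ≤ LH * (beta * ‖p‖) := by
    have h := hHlip (y - beta • g) (y - beta • (g + p))
    rwa [show y - beta • g - (y - beta • (g + p)) = beta • p by module, norm_smul,
      Real.norm_of_nonneg hbeta] at h
  set q := -(alpha • f) + (H y - H (y - beta • g)) + -(alpha • n)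
    + (H (y - beta • g) - H (y - beta • (g + p))) with hq
  have hdecomp : x - alpha • (f + n) - H (y - beta • (g + p)) = u + q := by
    simp only [u, hq, smul_add]; abel
  have hq2 : ‖q‖ ^ 2 ≤ 4 * (alpha ^ 2 * (LF ^ 2 * ‖u‖ ^ 2) + LH ^ 2 * beta ^ 2 * ‖g‖ ^ 2
      + alpha ^ 2 * ‖n‖ ^ 2 + LH ^ 2 * beta ^ 2 * ‖p‖ ^ 2) := by
    refine (sq_norm_add_four_le _ _ _ _).trans ?_
    have h1 := pow_le_pow_left₀ (norm_nonneg _) hdrift 2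
    have h2 := pow_le_pow_left₀ (norm_nonneg _) hnoise 2
    have h3 := mul_le_mul_of_nonneg_left (pow_le_pow_left₀ (norm_nonneg _) hf 2) (sq_nonneg alpha)
    rw [norm_neg, norm_neg, norm_smul, norm_smul, Real.norm_of_nonneg halpha]
    nlinarith
  have hinner : ⟪u, q⟫ = -alpha * ⟪u, f⟫ + ⟪u, H y - H (y - beta • g)⟫ - alpha * ⟪u, n⟫
      + ⟪u, r⟫ + beta * ⟪u, T p⟫ := by
    have : H (y - beta • g) - H (y - beta • (g + p)) = r + beta • T p := by
      rw [hr, map_smul]; abel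
    rw [hq, this]
    simp only [inner_add_right, inner_neg_right, real_inner_smul_right]
    ring
  have h1 : ⟪u, H y - H (y - beta • g)⟫ ≤ ‖u‖ * (LH * (beta * ‖g‖)) :=
    (real_inner_le_norm _ _).trans (mul_le_mul_of_nonneg_left hdrift (norm_nonneg _))
  have h2 : ⟪u, r⟫ ≤ ‖u‖ * ‖r‖ := real_inner_le_norm _ _
  have h3 := mul_le_mul_of_nonneg_left hmono halpha
  rw [hdecomp, norm_add_sq_real, hinner]
  nlinarith

theorem sq_norm_slow_residual_le {LGx muG beta a : ℝ} (hbeta : 0 ≤ beta)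
    (w g g₀ p : E₂) (hg : ‖g - g₀‖ ≤ LGx * a) (hmono : muG * ‖w‖ ^ 2 ≤ ⟪w, g₀⟫) :
    ‖w - beta • (g + p)‖ ^ 2 ≤
      (1 - 2 * muG * beta) * ‖w‖ ^ 2 + 2 * LGx * beta * a * ‖w‖ + 2 * beta ^ 2 * ‖g‖ ^ 2
        - 2 * beta * ⟪w, p⟫ + 2 * beta ^ 2 * ‖p‖ ^ 2 := by
  have h1 : ‖g + p‖ ^ 2 ≤ 2 * ‖g‖ ^ 2 + 2 * ‖p‖ ^ 2 := by
    refine (pow_le_pow_left₀ (norm_nonneg _) (norm_add_le g p) 2).trans ?_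
    nlinarith [sq_nonneg (‖g‖ - ‖p‖)]
  have h2 : -⟪w, g - g₀⟫ ≤ ‖w‖ * (LGx * a) :=
    (neg_le_abs _).trans <| (abs_real_inner_le_norm _ _).trans <|
      mul_le_mul_of_nonneg_left hg (norm_nonneg _)
  have h3 : ⟪w, g + p⟫ = ⟪w, g₀⟫ + ⟪w, g - g₀⟫ + ⟪w, p⟫ := by
    rw [← inner_add_right, ← inner_add_right]; congr 1; abel
  rw [norm_sub_sq_real, real_inner_smul_right, norm_smul, mul_pow, Real.norm_of_nonneg hbeta, h3]
  have h4 := mul_le_mul_of_nonneg_left h1 (sq_nonneg beta)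
  have h5 := mul_le_mul_of_nonneg_left h2 hbeta
  have h6 := mul_le_mul_of_nonneg_left hmono hbeta
  nlinarith

/-- The deterministic structure of a two-time-scale system with fast map `F`, slow map `G`,
fast equilibrium `H` and slow root `ystar`. -/
structure IsTwoTimeScaleSystem (F : E₁ → E₂ → E₁) (G : E₁ → E₂ → E₂) (H : E₂ → E₁) (ystar : E₂)
    (LH LF LGx LGy muF muG : ℝ) : Prop where
  LH_nonneg : 0 ≤ LH
  muF_pos : 0 < muF
  muG_pos : 0 < muG
  norm_H_sub_le : ∀ y₁ y₂, ‖H y₁ - H y₂‖ ≤ LH * ‖y₁ - y₂‖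
  norm_F_le : ∀ x y, ‖F x y‖ ≤ LF * ‖x - H y‖
  norm_G_sub_le : ∀ x y, ‖G x y - G (H y) y‖ ≤ LGx * ‖x - H y‖
  norm_G_le : ∀ y, ‖G (H y) y‖ ≤ LGy * ‖y - ystar‖
  F_mono : ∀ x y, muF * ‖x - H y‖ ^ 2 ≤ ⟪x - H y, F x y⟫
  G_mono : ∀ y, muG * ‖y - ystar‖ ^ 2 ≤ ⟪y - ystar, G (H y) y⟫

theorem IsTwoTimeScaleSystem.lipschitzWith_H {F : E₁ → E₂ → E₁} {G : E₁ → E₂ → E₂} {H : E₂ → E₁}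
    {ystar : E₂} {LH LF LGx LGy muF muG : ℝ}
    (sys : IsTwoTimeScaleSystem F G H ystar LH LF LGx LGy muF muG) :
    LipschitzWith LH.toNNReal H :=
  LipschitzWith.of_dist_le_mul fun a b => by
    simpa [dist_eq_norm, Real.coe_toNNReal _ sys.LH_nonneg] using sys.norm_H_sub_le a b

theorem IsTwoTimeScaleSystem.continuous_H {F : E₁ → E₂ → E₁} {G : E₁ → E₂ → E₂} {H : E₂ → E₁}
    {ystar : E₂} {LH LF LGx LGy muF muG : ℝ}
    (sys : IsTwoTimeScaleSystem F G H ystar LH LF LGx LGy muF muG) : Continuous H :=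
  sys.lipschitzWith_H.continuous

theorem IsTwoTimeScaleSystem.norm_G_le_add {F : E₁ → E₂ → E₁} {G : E₁ → E₂ → E₂} {H : E₂ → E₁}
    {ystar : E₂} {LH LF LGx LGy muF muG : ℝ}
    (sys : IsTwoTimeScaleSystem F G H ystar LH LF LGx LGy muF muG) (x : E₁) (y : E₂) :
    ‖G x y‖ ≤ LGx * ‖x - H y‖ + LGy * ‖y - ystar‖ := by
  simpa using (norm_add_le (G x y - G (H y) y) (G (H y) y)).trans
    (add_le_add (sys.norm_G_sub_le x y) (sys.norm_G_le y))

/-- The growth rate of the Lyapunov function per unit of `alpha ^ 2`. -/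
def lyapGrowth (LH LF LGx LGy muF muG lam : ℝ) : ℝ :=
  4 * LF ^ 2 + (8 * LH ^ 2 + 4 * lam) * (muF / muG) ^ 2 * (LGx ^ 2 + LGy ^ 2 / lam)

theorem drift_quadratic_form_le {LH LF LGx LGy muF muG lam alpha beta a b c : ℝ}
    (hLH : 0 ≤ LH) (hmuF : 0 < muF)
    (hmuG : 0 < muG) (hlam : 0 < lam) (hbalance : lam * LGx = LH * LGy)
    (halpha : 0 ≤ alpha) (hbeta : 0 ≤ beta) (ha : 0 ≤ a) (hc : 0 ≤ c)
    (hcab : c ≤ LGx * a + LGy * b)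
    (h₁ : 28 * (LH * LGx) * beta ≤ muF * alpha)
    (h₂ : 28 * (LH * LGx * LGy) * beta ≤ muF * muG * alpha)
    (h₃ : beta ≤ muF / muG * alpha) :
    (1 - 2 * muF * alpha + 4 * LF ^ 2 * alpha ^ 2) * a ^ 2 + 2 * LH * beta * a * c
        + 4 * LH ^ 2 * beta ^ 2 * c ^ 2
        + lam * ((1 - 2 * muG * beta) * b ^ 2 + 2 * LGx * beta * a * b + 2 * beta ^ 2 * c ^ 2) ≤
      (1 + lyapGrowth LH LF LGx LGy muF muG lam * alpha ^ 2 - muG * beta) * (a ^ 2 + lam * b ^ 2) - muF * alpha / 2 * a ^ 2 := by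
  unfold lyapGrowth
  have hβ2 : beta ^ 2 ≤ (muF / muG) ^ 2 * alpha ^ 2 := by
    rw [← mul_pow]; exact pow_le_pow_left₀ hbeta h₃ 2
  have hβ1 : muG * beta ≤ muF * alpha := by
    have := mul_le_mul_of_nonneg_left h₃ hmuG.le
    rwa [show muG * (muF / muG * alpha) = muF * alpha by field_simp] at this
  have hc2 : c ^ 2 ≤ 2 * (LGx ^ 2 + LGy ^ 2 / lam) * (a ^ 2 + lam * b ^ 2) := by
    have h : 2 * (LGx ^ 2 + LGy ^ 2 / lam) * (a ^ 2 + lam * b ^ 2) =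
        2 * LGx ^ 2 * a ^ 2 + 2 * LGy ^ 2 * b ^ 2 + 2 * LGx ^ 2 * lam * b ^ 2
          + 2 * (LGy ^ 2 / lam) * a ^ 2 := by
      field_simp; ring
    have h' : 0 ≤ 2 * LGx ^ 2 * lam * b ^ 2 + 2 * (LGy ^ 2 / lam) * a ^ 2 := by positivity
    have := pow_le_pow_left₀ hc hcab 2
    nlinarith [sq_nonneg (LGx * a - LGy * b)]
  have hsecond : (4 * LH ^ 2 + 2 * lam) * (beta ^ 2 * c ^ 2) ≤ (4 * LH ^ 2 + 2 * lam) *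
      ((muF / muG) ^ 2 * alpha ^ 2 * (2 * (LGx ^ 2 + LGy ^ 2 / lam) * (a ^ 2 + lam * b ^ 2))) :=
    mul_le_mul_of_nonneg_left (mul_le_mul hβ2 hc2 (sq_nonneg _) (by positivity)) (by positivity)
  have hcross : 4 * LH * LGy * beta * (a * b) ≤
      lam * muG * beta * b ^ 2 + muF * alpha / 7 * a ^ 2 := by
    have h4 : 4 * LH * LGy * LGx * beta ≤ muG * (muF * alpha / 7) := by linarith
    have h5 := mul_le_mul_of_nonneg_right h4 (sq_nonneg a)
    have h6 : muG * (4 * LH * LGy * beta * (a * b)) ≤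
        muG * (lam * muG * beta * b ^ 2 + muF * alpha / 7 * a ^ 2) := by
      have h7 : 0 ≤ lam * beta * (muG * b - 2 * LGx * a) ^ 2 := by positivity
      have h8 : lam * beta * (muG * b - 2 * LGx * a) ^ 2 =
          muG * (lam * muG * beta * b ^ 2) - 4 * muG * beta * (lam * LGx) * (a * b)
            + 4 * LGx * beta * (lam * LGx) * a ^ 2 := by ring
      rw [hbalance] at h8
      nlinarith
    exact le_of_mul_le_mul_left h6 hmuG
  have hfirst : 2 * LH * beta * a * c ≤ 2 * LH * beta * a * (LGx * a + LGy * b) :=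
    mul_le_mul_of_nonneg_left hcab (by positivity)
  have hself : 2 * (LH * LGx) * beta * a ^ 2 ≤ muF * alpha / 14 * a ^ 2 :=
    mul_le_mul_of_nonneg_right (by linarith) (sq_nonneg a)
  have hrate := mul_le_mul_of_nonneg_right hβ1 (sq_nonneg a)
  have hα : 0 ≤ muF * alpha * a ^ 2 := by positivity
  have hb2 : lam * (2 * LGx * beta * a * b) = 2 * LH * LGy * beta * (a * b) := by
    linear_combination (2 * beta * a * b) * hbalance
  have hextra : 0 ≤ 4 * LF ^ 2 * alpha ^ 2 * (lam * b ^ 2) := by positivity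
  nlinarith

theorem IsTwoTimeScaleSystem.lyapunov_step_le
    {F : E₁ → E₂ → E₁} {G : E₁ → E₂ → E₂} {H : E₂ → E₁} {ystar : E₂}
    {LH LF LGx LGy muF muG lam alpha beta : ℝ}
    (sys : IsTwoTimeScaleSystem F G H ystar LH LF LGx LGy muF muG)
    (hlam : 0 < lam) (hbalance : lam * LGx = LH * LGy)
    (halpha : 0 ≤ alpha) (hbeta : 0 ≤ beta)
    (h₁ : 28 * (LH * LGx) * beta ≤ muF * alpha)
    (h₂ : 28 * (LH * LGx * LGy) * beta ≤ muF * muG * alpha)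
    (h₃ : beta ≤ muF / muG * alpha) (T : E₂ →L[ℝ] E₁) (x n : E₁) (y p : E₂) :
    ‖x - alpha • (F x y + n) - H (y - beta • (G x y + p))‖ ^ 2
        + lam * ‖y - beta • (G x y + p) - ystar‖ ^ 2 ≤
      (1 + lyapGrowth LH LF LGx LGy muF muG lam * alpha ^ 2 - muG * beta)
          * (‖x - H y‖ ^ 2 + lam * ‖y - ystar‖ ^ 2)
        - muF * alpha / 2 * ‖x - H y‖ ^ 2
        + 2 * ‖x - H y‖ *
          ‖H (y - beta • G x y) - H (y - beta • (G x y + p)) - T (beta • p)‖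
        - 2 * alpha * ⟪x - H y, n⟫ + 2 * beta * ⟪x - H y, T p⟫
        - 2 * lam * beta * ⟪y - ystar, p⟫
        + 4 * alpha ^ 2 * ‖n‖ ^ 2
        + (4 * LH ^ 2 + 2 * lam) * (muF / muG) ^ 2 * alpha ^ 2 * ‖p‖ ^ 2 := by
  have hβ2 : beta ^ 2 ≤ (muF / muG) ^ 2 * alpha ^ 2 := by
    rw [← mul_pow]; exact pow_le_pow_left₀ hbeta h₃ 2
  have hG := sys.norm_G_le_add x y
  have hfast := sq_norm_fast_residual_le halpha hbeta sys.norm_H_sub_le T x (F x y) n y (G x y) p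
    (sys.norm_F_le x y) (sys.F_mono x y)
  have hslow := mul_le_mul_of_nonneg_left (sq_norm_slow_residual_le hbeta (y - ystar) (G x y)
    (G (H y) y) p (sys.norm_G_sub_le x y) (sys.G_mono y)) hlam.le
  have hquad := drift_quadratic_form_le (LF := LF) sys.LH_nonneg sys.muF_pos sys.muG_pos hlam
    hbalance halpha hbeta (norm_nonneg (x - H y)) (norm_nonneg (G x y)) hG h₁ h₂ h₃
  have hp := mul_le_mul_of_nonneg_left hβ2
    (show 0 ≤ (4 * LH ^ 2 + 2 * lam) * ‖p‖ ^ 2 by positivity)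
  rw [sub_right_comm y]
  linarith

end OneStep

section Stochastic

variable {Ω : Type*} {m m0 : MeasurableSpace Ω} {μ : Measure Ω}

theorem MeasureTheory.MemLp.integrable_real_inner {E : Type*} [NormedAddCommGroup E]
    [InnerProductSpace ℝ E] {f g : Ω → E} (hf : MemLp f 2 μ) (hg : MemLp g 2 μ) :
    Integrable (fun ω => ⟪f ω, g ω⟫) μ :=
  (hf.norm.integrable_mul hg.norm).mono' (hf.1.inner hg.1)
    (ae_of_all _ fun _ => norm_inner_le_norm _ _)

theorem condExp_real_inner_eq_zero {E : Type*} [NormedAddCommGroup E] [InnerProductSpace ℝ E]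
    [CompleteSpace E] [IsFiniteMeasure μ] {f g : Ω → E} (hfm : StronglyMeasurable[m] f)
    (hf : MemLp f 2 μ) (hg : MemLp g 2 μ) (hzero : μ[g | m] =ᵐ[μ] 0) :
    μ[fun ω => ⟪f ω, g ω⟫ | m] =ᵐ[μ] 0 := by
  have h : μ[fun ω => ⟪f ω, g ω⟫ | m] =ᵐ[μ] fun ω => ⟪f ω, (μ[g | m]) ω⟫ :=
    condExp_bilin_of_stronglyMeasurable_left (innerSL ℝ) hfm
      (hf.integrable_real_inner hg) (hg.integrable one_le_two)
  filter_upwards [h, hzero] with ω h₁ h₂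
  rw [h₁, h₂, Pi.zero_apply, inner_zero_right, Pi.zero_apply]

variable {E₁ E₂ : Type*} [NormedAddCommGroup E₁] [InnerProductSpace ℝ E₁]
  [NormedAddCommGroup E₂] [InnerProductSpace ℝ E₂]

theorem norm_taylor_remainder_le {H : E₂ → E₁} {SH dH beta : ℝ} (hSH : 0 ≤ SH)
    (hdH : dH ∈ Set.Icc (0 : ℝ) 1)
    (htaylor : ∀ y₁ y₂, ‖H y₁ - H y₂ - fderiv ℝ H y₂ (y₁ - y₂)‖ ≤ SH * ‖y₁ - y₂‖ ^ (1 + dH))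
    (hbeta : 0 ≤ beta) (d p : E₂) :
    ‖H d - H (d - beta • p) - fderiv ℝ H d (beta • p)‖ ≤
      SH * beta ^ (1 + dH) * (1 + ‖p‖ ^ 2) := by
  have h := htaylor (d - beta • p) d
  rw [sub_sub_cancel_left, map_neg, norm_neg, norm_smul, Real.norm_of_nonneg hbeta,
    Real.mul_rpow hbeta (norm_nonneg _), ← mul_assoc] at h
  have hp : ‖p‖ ^ (1 + dH) ≤ 1 + ‖p‖ ^ 2 := by
    rcases le_total ‖p‖ 1 with h1 | h1
    · have := Real.rpow_le_one (norm_nonneg p) h1 (by linarith [hdH.1] : 0 ≤ 1 + dH)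
      nlinarith [sq_nonneg ‖p‖]
    · have := Real.rpow_le_rpow_of_exponent_le h1 (by linarith [hdH.2] : 1 + dH ≤ 2)
      rw [Real.rpow_two] at this
      linarith
  calc ‖H d - H (d - beta • p) - fderiv ℝ H d (beta • p)‖
      = ‖H (d - beta • p) - H d - -fderiv ℝ H d (beta • p)‖ := by
        rw [← norm_neg]; congr 1; abel
    _ ≤ _ := h
    _ ≤ _ := mul_le_mul_of_nonneg_left hp (by positivity)

variable [FiniteDimensional ℝ E₁] [MeasurableSpace E₁] [BorelSpace E₁]
  [FiniteDimensional ℝ E₂] [MeasurableSpace E₂] [BorelSpace E₂]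

theorem IsTwoTimeScaleSystem.condExp_lyapunov_le [IsProbabilityMeasure μ] (hm : m ≤ m0)
    {F : E₁ → E₂ → E₁} {G : E₁ → E₂ → E₂} {H : E₂ → E₁} {ystar : E₂}
    {LH LF LGx LGy muF muG lam alpha beta SH dH Γ11 Γ22 : ℝ}
    (sys : IsTwoTimeScaleSystem F G H ystar LH LF LGx LGy muF muG)
    (hlam : 0 < lam) (hbalance : lam * LGx = LH * LGy) (hSH : 0 ≤ SH)
    (hdH : dH ∈ Set.Icc (0 : ℝ) 1)
    (htaylor : ∀ y₁ y₂, ‖H y₁ - H y₂ - fderiv ℝ H y₂ (y₁ - y₂)‖ ≤ SH * ‖y₁ - y₂‖ ^ (1 + dH))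
    (hG : Measurable fun p : E₁ × E₂ => G p.1 p.2)
    (halpha : 0 < alpha) (hbeta : 0 < beta)
    (h₁ : 28 * (LH * LGx) * beta ≤ muF * alpha)
    (h₂ : 28 * (LH * LGx * LGy) * beta ≤ muF * muG * alpha)
    (h₃ : beta ≤ muF / muG * alpha)
    {X N : Ω → E₁} {Y P : Ω → E₂} (hX : Measurable[m] X) (hY : Measurable[m] Y)
    (hXL2 : MemLp (fun ω => X ω - H (Y ω)) 2 μ) (hYL2 : MemLp (fun ω => Y ω - ystar) 2 μ)
    (hN : MemLp N 2 μ) (hP : MemLp P 2 μ)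
    (hNmean : μ[N | m] =ᵐ[μ] 0) (hPmean : μ[P | m] =ᵐ[μ] 0)
    (hN2 : ∀ᵐ ω ∂μ, (μ[fun ω' => ‖N ω'‖ ^ 2 | m]) ω ≤ Γ11)
    (hP2 : ∀ᵐ ω ∂μ, (μ[fun ω' => ‖P ω'‖ ^ 2 | m]) ω ≤ Γ22)
    {V' : Ω → ℝ} (hV' : Integrable V' μ)
    (hV'eq : ∀ ω, V' ω =
      ‖X ω - alpha • (F (X ω) (Y ω) + N ω) - H (Y ω - beta • (G (X ω) (Y ω) + P ω))‖ ^ 2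
        + lam * ‖Y ω - beta • (G (X ω) (Y ω) + P ω) - ystar‖ ^ 2) :
    μ[V' | m] ≤ᵐ[μ] fun ω =>
      (1 + lyapGrowth LH LF LGx LGy muF muG lam * alpha ^ 2 - muG * beta)
          * (‖X ω - H (Y ω)‖ ^ 2 + lam * ‖Y ω - ystar‖ ^ 2)
        + ((4 * Γ11 + (4 * LH ^ 2 + 2 * lam) * (muF / muG) ^ 2 * Γ22) * alpha ^ 2
          + 2 * (SH * (1 + Γ22)) ^ 2 / muF * (beta ^ (2 + 2 * dH) / alpha)) := by
  have : ProperSpace E₁ := FiniteDimensional.proper ℝ E₁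
  have : ProperSpace E₂ := FiniteDimensional.proper ℝ E₂
  have hLip := sys.lipschitzWith_H
  have hHm : Measurable H := hLip.continuous.measurable
  have hT : ∀ y, ‖fderiv ℝ H y‖ ≤ LH := fun y => by
    simpa [Real.coe_toNNReal _ sys.LH_nonneg] using norm_fderiv_le_of_lipschitz ℝ hLip (x₀ := y)
  have hd : Measurable[m] fun ω => Y ω - beta • G (X ω) (Y ω) :=
    hY.sub ((hG.comp (hX.prodMk hY)).const_smul beta)
  have hTm : StronglyMeasurable[m] fun ω => fderiv ℝ H (Y ω - beta • G (X ω) (Y ω)) :=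
    ((measurable_fderiv ℝ H).comp hd).stronglyMeasurable
  have hu : StronglyMeasurable[m] fun ω => X ω - H (Y ω) :=
    (hX.sub (hHm.comp hY)).stronglyMeasurable
  have hw : StronglyMeasurable[m] fun ω => Y ω - ystar := (hY.sub_const ystar).stronglyMeasurable
  set T : Ω → E₂ →L[ℝ] E₁ := fun ω => fderiv ℝ H (Y ω - beta • G (X ω) (Y ω)) with hTdef
  set h : Ω → E₂ := fun ω =>
    (2 * beta) • (T ω).adjoint (X ω - H (Y ω)) - (2 * lam * beta) • (Y ω - ystar) with hh
  have hadj : StronglyMeasurable[m] fun ω => (T ω).adjoint (X ω - H (Y ω)) :=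
    isBoundedBilinearMap_apply.continuous.comp_stronglyMeasurable
      ((ContinuousLinearMap.adjoint.continuous.comp_stronglyMeasurable hTm).prodMk hu)
  have hhm : StronglyMeasurable[m] h := (hadj.const_smul _).sub (hw.const_smul _)
  have hadjL2 : MemLp (fun ω => (T ω).adjoint (X ω - H (Y ω))) 2 μ := by
    refine hXL2.of_le_mul (c := LH) (hadj.mono hm).aestronglyMeasurable (ae_of_all _ fun ω => ?_)
    refine (ContinuousLinearMap.le_opNorm _ _).trans ?_
    rw [LinearIsometryEquiv.norm_map]
    exact mul_le_mul_of_nonneg_right (hT _) (norm_nonneg _)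
  have hhL2 : MemLp h 2 μ := (hadjL2.const_smul _).sub (hYL2.const_smul _)
  set R : Ω → ℝ := fun ω => ‖H (Y ω - beta • G (X ω) (Y ω))
    - H (Y ω - beta • (G (X ω) (Y ω) + P ω)) - T ω (beta • P ω)‖ with hR
  have hRL2 : MemLp R 2 μ := by
    have hPm := hP.1
    have hd' := (hd.mono hm le_rfl).aestronglyMeasurable (μ := μ)
    have hmeas : AEStronglyMeasurable R μ := by
      have h1 := hLip.continuous.comp_aestronglyMeasurable hd'
      have h2 := hLip.continuous.comp_aestronglyMeasurable (hd'.sub (hPm.const_smul beta))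
      have h3 := isBoundedBilinearMap_apply.continuous.comp_aestronglyMeasurable
        ((hTm.mono hm).aestronglyMeasurable (μ := μ).prodMk (hPm.const_smul beta))
      refine ((h1.sub h2).sub h3).norm.congr (ae_of_all _ fun ω => ?_)
      simp [hR, smul_add, sub_sub]
    refine hP.of_le_mul (c := 2 * LH * beta) hmeas (ae_of_all _ fun ω => ?_)
    have h1 := sys.norm_H_sub_le (Y ω - beta • G (X ω) (Y ω))
      (Y ω - beta • (G (X ω) (Y ω) + P ω))
    rw [show Y ω - beta • G (X ω) (Y ω) - (Y ω - beta • (G (X ω) (Y ω) + P ω)) = beta • P ω by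
      module, norm_smul, Real.norm_of_nonneg hbeta.le] at h1
    have h2 := (T ω).le_of_opNorm_le (hT _) (beta • P ω)
    rw [norm_smul, Real.norm_of_nonneg hbeta.le] at h2
    have h3 := norm_sub_le (H (Y ω - beta • G (X ω) (Y ω))
      - H (Y ω - beta • (G (X ω) (Y ω) + P ω))) (T ω (beta • P ω))
    simp only [hR, norm_norm]
    linarith
  have hRcond : ∀ᵐ ω ∂μ, (μ[R | m]) ω ≤ SH * beta ^ (1 + dH) * (1 + Γ22) := by
    have hint : Integrable (fun ω => 1 + ‖P ω‖ ^ 2) μ :=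
      (integrable_const _).add hP.norm.integrable_sq
    have h1 : μ[R | m] ≤ᵐ[μ] μ[(SH * beta ^ (1 + dH)) • fun ω => 1 + ‖P ω‖ ^ 2 | m] := by
      refine condExp_mono (hRL2.integrable one_le_two) (hint.smul _) (ae_of_all _ fun ω => ?_)
      have := norm_taylor_remainder_le hSH hdH htaylor hbeta.le
        (Y ω - beta • G (X ω) (Y ω)) (P ω)
      simpa [hR, hTdef, smul_add, sub_sub] using this
    have h2 := condExp_smul (μ := μ) (SH * beta ^ (1 + dH)) (fun ω => 1 + ‖P ω‖ ^ 2) m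
    have h3 := condExp_add (m := m) (integrable_const (μ := μ) (1 : ℝ)) hP.norm.integrable_sq
    filter_upwards [h1, h2, h3, hP2] with ω g1 g2 g3 g4
    refine g1.trans ?_
    rw [g2, Pi.smul_apply, smul_eq_mul]
    refine mul_le_mul_of_nonneg_left ?_ (by positivity)
    erw [g3]
    rw [Pi.add_apply, condExp_const hm]
    linarith
  set B : Ω → ℝ := fun ω =>
    (1 + lyapGrowth LH LF LGx LGy muF muG lam * alpha ^ 2 - muG * beta)
      * (‖X ω - H (Y ω)‖ ^ 2 + lam * ‖Y ω - ystar‖ ^ 2)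
    - muF * alpha / 2 * ‖X ω - H (Y ω)‖ ^ 2 with hB
  have hBm : StronglyMeasurable[m] B :=
    (((hu.norm.pow 2).add ((hw.norm.pow 2).const_mul lam)).const_mul _).sub
      ((hu.norm.pow 2).const_mul _)
  have hBint : Integrable B μ :=
    ((hXL2.norm.integrable_sq.add (hYL2.norm.integrable_sq.const_mul lam)).const_mul _).sub
      (hXL2.norm.integrable_sq.const_mul _)
  set c₁ := 4 * alpha ^ 2
  set c₂ := (4 * LH ^ 2 + 2 * lam) * (muF / muG) ^ 2 * alpha ^ 2
  set a : Ω → ℝ := fun ω => 2 * ‖X ω - H (Y ω)‖ with ha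
  have ham : StronglyMeasurable[m] a := hu.norm.const_mul 2
  have haR : Integrable (a * R) μ := (hXL2.norm.const_mul 2).integrable_mul hRL2
  set k : Ω → E₁ := fun ω => (-(2 * alpha)) • (X ω - H (Y ω)) with hk
  have hkm : StronglyMeasurable[m] k := hu.const_smul _
  have hkL2 : MemLp k 2 μ := hXL2.const_smul _
  have hkN := hkL2.integrable_real_inner hN
  have hhP := hhL2.integrable_real_inner hP
  have hN2int := hN.norm.integrable_sq.smul c₁
  have hP2int := hP.norm.integrable_sq.smul c₂
  have hmono : μ[V' | m] ≤ᵐ[μ] μ[B + a * R + (fun ω => ⟪k ω, N ω⟫) + (fun ω => ⟪h ω, P ω⟫)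
      + (c₁ • fun ω => ‖N ω‖ ^ 2) + (c₂ • fun ω => ‖P ω‖ ^ 2) | m] := by
    refine condExp_mono hV' (((((hBint.add haR).add hkN).add hhP).add hN2int).add hP2int)
      (ae_of_all _ fun ω => ?_)
    have := sys.lyapunov_step_le hlam hbalance halpha.le hbeta.le h₁ h₂ h₃ (T ω) (X ω) (N ω) (Y ω)
      (P ω)
    rw [← hV'eq] at this
    simp only [inner_sub_left] at this
    simp only [Pi.add_apply, Pi.mul_apply, Pi.smul_apply, smul_eq_mul, hB, ha, hk, hh, hR,
      inner_sub_left, real_inner_smul_left, ContinuousLinearMap.adjoint_inner_left]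
    linarith
  have e1 := condExp_add (m := m) ((((hBint.add haR).add hkN).add hhP).add hN2int) hP2int
  have e2 := condExp_add (m := m) (((hBint.add haR).add hkN).add hhP) hN2int
  have e3 := condExp_add (m := m) ((hBint.add haR).add hkN) hhP
  have e4 := condExp_add (m := m) (hBint.add haR) hkN
  have e5 := condExp_add (m := m) hBint haR
  have e6 := condExp_mul_of_stronglyMeasurable_left ham haR (hRL2.integrable one_le_two)
  have e7 := condExp_smul (μ := μ) c₁ (fun ω => ‖N ω‖ ^ 2) m
  have e8 := condExp_smul (μ := μ) c₂ (fun ω => ‖P ω‖ ^ 2) m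
  have e9 := condExp_real_inner_eq_zero hkm hkL2 hN hNmean
  have e10 := condExp_real_inner_eq_zero hhm hhL2 hP hPmean
  have e11 := condExp_of_stronglyMeasurable hm hBm hBint
  have hc₁ : 0 ≤ c₁ := by positivity
  have hc₂ : 0 ≤ c₂ := by positivity
  filter_upwards [hmono, e1, e2, e3, e4, e5, e6, e7, e8, e9, e10, hRcond, hN2, hP2] with ω
    g g1 g2 g3 g4 g5 g6 g7 g8 g9 g10 gR gN gP
  refine g.trans ?_
  rw [g1, Pi.add_apply, g2, Pi.add_apply, g3, Pi.add_apply, g4, Pi.add_apply, g5, Pi.add_apply,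
    g6, g7, g8, g9, g10, e11]
  simp only [Pi.mul_apply, Pi.smul_apply, smul_eq_mul, Pi.zero_apply, ha, hB]
  have hyoung : 2 * ‖X ω - H (Y ω)‖ * (SH * beta ^ (1 + dH) * (1 + Γ22)) ≤
      muF * alpha / 2 * ‖X ω - H (Y ω)‖ ^ 2
        + 2 * (SH * (1 + Γ22)) ^ 2 / muF * (beta ^ (2 + 2 * dH) / alpha) := by
    have hpow : beta ^ (2 + 2 * dH) = (beta ^ (1 + dH)) ^ 2 := by
      rw [← Real.rpow_natCast, ← Real.rpow_mul hbeta.le]; congr 1; push_cast; ring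
    have hF := sys.muF_pos
    have key : muF * alpha / 2 * ‖X ω - H (Y ω)‖ ^ 2
        + 2 * (SH * (1 + Γ22)) ^ 2 / muF * (beta ^ (2 + 2 * dH) / alpha)
        - 2 * ‖X ω - H (Y ω)‖ * (SH * beta ^ (1 + dH) * (1 + Γ22)) =
        (muF * alpha * ‖X ω - H (Y ω)‖ - 2 * (SH * beta ^ (1 + dH) * (1 + Γ22))) ^ 2
          / (2 * (muF * alpha)) := by
      rw [hpow]; field_simp; ring
    have : 0 ≤ (muF * alpha * ‖X ω - H (Y ω)‖ - 2 * (SH * beta ^ (1 + dH) * (1 + Γ22))) ^ 2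
          / (2 * (muF * alpha)) := by positivity
    linarith
  have hR' := mul_le_mul_of_nonneg_left gR
    (mul_nonneg zero_le_two (norm_nonneg (X ω - H (Y ω))))
  have hN' := mul_le_mul_of_nonneg_left gN hc₁
  have hP' := mul_le_mul_of_nonneg_left gP hc₂
  have hfin : c₁ * Γ11 + c₂ * Γ22 =
      (4 * Γ11 + (4 * LH ^ 2 + 2 * lam) * (muF / muG) ^ 2 * Γ22) * alpha ^ 2 := by
    simp only [c₁, c₂]; ring
  linarith

theorem IsTwoTimeScaleSystem.memLp_step {F : E₁ → E₂ → E₁} {G : E₁ → E₂ → E₂}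
    {H : E₂ → E₁} {ystar : E₂} {LH LF LGx LGy muF muG : ℝ}
    (sys : IsTwoTimeScaleSystem F G H ystar LH LF LGx LGy muF muG)
    (hF : Measurable fun p : E₁ × E₂ => F p.1 p.2) (hG : Measurable fun p : E₁ × E₂ => G p.1 p.2)
    (alpha beta : ℝ) {X N : Ω → E₁} {Y P : Ω → E₂} (hX : Measurable X) (hY : Measurable Y)
    (hXL2 : MemLp (fun ω => X ω - H (Y ω)) 2 μ) (hYL2 : MemLp (fun ω => Y ω - ystar) 2 μ)
    (hN : MemLp N 2 μ) (hP : MemLp P 2 μ) :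
    MemLp (fun ω => X ω - alpha • (F (X ω) (Y ω) + N ω)
        - H (Y ω - beta • (G (X ω) (Y ω) + P ω))) 2 μ ∧
      MemLp (fun ω => Y ω - beta • (G (X ω) (Y ω) + P ω) - ystar) 2 μ := by
  have : ProperSpace E₁ := FiniteDimensional.proper ℝ E₁
  have : ProperSpace E₂ := FiniteDimensional.proper ℝ E₂
  have hFL2 : MemLp (fun ω => F (X ω) (Y ω)) 2 μ :=
    hXL2.of_le_mul (hF.comp (hX.prodMk hY)).aestronglyMeasurable
      (ae_of_all _ fun ω => sys.norm_F_le _ _)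
  have hGL2 : MemLp (fun ω => G (X ω) (Y ω)) 2 μ :=
    ((hXL2.norm.const_mul LGx).add (hYL2.norm.const_mul LGy)).mono'
      (hG.comp (hX.prodMk hY)).aestronglyMeasurable
      (ae_of_all _ fun ω => sys.norm_G_le_add _ _)
  have hstep : MemLp (fun ω => beta • (G (X ω) (Y ω) + P ω)) 2 μ := (hGL2.add hP).const_smul beta
  have hdiff : MemLp (fun ω => H (Y ω) - H (Y ω - beta • (G (X ω) (Y ω) + P ω))) 2 μ := by
    refine hstep.of_le_mul (c := LH) ?_ (ae_of_all _ fun ω => ?_)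
    · exact (sys.continuous_H.comp_aestronglyMeasurable hY.aestronglyMeasurable).sub
        (sys.continuous_H.comp_aestronglyMeasurable (hY.aestronglyMeasurable.sub hstep.1))
    · simpa using sys.norm_H_sub_le (Y ω) (Y ω - beta • (G (X ω) (Y ω) + P ω))
  constructor
  · refine ((hXL2.sub ((hFL2.add hN).const_smul alpha)).add hdiff).ae_eq
      (ae_of_all _ fun ω => ?_)
    simp only [Pi.add_apply, Pi.sub_apply, Pi.smul_apply]
    abel
  · refine (hYL2.sub hstep).ae_eq (ae_of_all _ fun ω => ?_)
    simp only [Pi.sub_apply]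
    abel

theorem IsTwoTimeScaleSystem.ae_tendsto_zero [IsProbabilityMeasure μ] {ℱ : Filtration ℕ m0}
    {F : E₁ → E₂ → E₁} {G : E₁ → E₂ → E₂} {H : E₂ → E₁} {ystar : E₂}
    {LH LF LGx LGy muF muG lam SH dH Γ11 Γ22 : ℝ} {alpha beta : ℕ → ℝ}
    (sys : IsTwoTimeScaleSystem F G H ystar LH LF LGx LGy muF muG)
    (hlam : 0 < lam) (hbalance : lam * LGx = LH * LGy) (hSH : 0 ≤ SH)
    (hdH : dH ∈ Set.Icc (0 : ℝ) 1)
    (htaylor : ∀ y₁ y₂, ‖H y₁ - H y₂ - fderiv ℝ H y₂ (y₁ - y₂)‖ ≤ SH * ‖y₁ - y₂‖ ^ (1 + dH))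
    (hF : Measurable fun p : E₁ × E₂ => F p.1 p.2) (hG : Measurable fun p : E₁ × E₂ => G p.1 p.2)
    (halpha : ∀ t, 0 < alpha t) (hbeta : ∀ t, 0 < beta t)
    (h₁ : ∀ t, 28 * (LH * LGx) * beta t ≤ muF * alpha t)
    (h₂ : ∀ t, 28 * (LH * LGx * LGy) * beta t ≤ muF * muG * alpha t)
    (h₃ : ∀ t, beta t ≤ muF / muG * alpha t)
    (hbsum : ¬ Summable beta) (hα2sum : Summable fun t => alpha t ^ 2)
    (hβδsum : Summable fun t => beta t ^ (2 + 2 * dH) / alpha t)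
    {x ξ : ℕ → Ω → E₁} {y ψ : ℕ → Ω → E₂}
    (hxupd : ∀ t ω, x (t + 1) ω = x t ω - alpha t • (F (x t ω) (y t ω) + ξ t ω))
    (hyupd : ∀ t ω, y (t + 1) ω = y t ω - beta t • (G (x t ω) (y t ω) + ψ t ω))
    (hx : ∀ t, Measurable[ℱ t] (x t)) (hy : ∀ t, Measurable[ℱ t] (y t))
    (hx0 : MemLp (fun ω => x 0 ω - H (y 0 ω)) 2 μ) (hy0 : MemLp (fun ω => y 0 ω - ystar) 2 μ)
    (hξ : ∀ t, MemLp (ξ t) 2 μ) (hψ : ∀ t, MemLp (ψ t) 2 μ)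
    (hξmean : ∀ t, μ[ξ t | ℱ t] =ᵐ[μ] 0) (hψmean : ∀ t, μ[ψ t | ℱ t] =ᵐ[μ] 0)
    (hΓ11 : 0 ≤ Γ11) (hΓ22 : 0 ≤ Γ22)
    (hξ2 : ∀ t, ∀ᵐ ω ∂μ, (μ[fun ω' => ‖ξ t ω'‖ ^ 2 | ℱ t]) ω ≤ Γ11)
    (hψ2 : ∀ t, ∀ᵐ ω ∂μ, (μ[fun ω' => ‖ψ t ω'‖ ^ 2 | ℱ t]) ω ≤ Γ22) :
    ∀ᵐ ω ∂μ, Tendsto (fun t => x t ω - H (y t ω)) atTop (nhds 0) ∧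
      Tendsto (fun t => y t ω - ystar) atTop (nhds 0) := by
  have : ProperSpace E₁ := FiniteDimensional.proper ℝ E₁
  have : ProperSpace E₂ := FiniteDimensional.proper ℝ E₂
  have hL2 : ∀ t, MemLp (fun ω => x t ω - H (y t ω)) 2 μ ∧ MemLp (fun ω => y t ω - ystar) 2 μ := by
    intro t
    induction t with
    | zero => exact ⟨hx0, hy0⟩
    | succ t ih =>
      simp only [hxupd, hyupd]
      exact sys.memLp_step hF hG (alpha t) (beta t) ((hx t).mono (ℱ.le t) le_rfl)
        ((hy t).mono (ℱ.le t) le_rfl) ih.1 ih.2 (hξ t) (hψ t)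
  set V : ℕ → Ω → ℝ := fun t ω => ‖x t ω - H (y t ω)‖ ^ 2 + lam * ‖y t ω - ystar‖ ^ 2 with hV
  have hVadp : StronglyAdapted ℱ V := fun t =>
    (((hx t).sub (sys.continuous_H.measurable.comp (hy t))).stronglyMeasurable.norm.pow 2).add
      ((((hy t).sub_const ystar).stronglyMeasurable.norm.pow 2).const_mul lam)
  have hVint : ∀ t, Integrable (V t) μ := fun t =>
    (hL2 t).1.norm.integrable_sq.add ((hL2 t).2.norm.integrable_sq.const_mul lam)
  have hmuF := sys.muF_pos
  have hmuG := sys.muG_pos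
  have hgrowth : 0 ≤ lyapGrowth LH LF LGx LGy muF muG lam := by unfold lyapGrowth; positivity
  have hVlim : ∀ᵐ ω ∂μ, Tendsto (fun t => V t ω) atTop (nhds 0) := by
    refine ae_tendsto_zero_of_condExp_le (η := fun t =>
        lyapGrowth LH LF LGx LGy muF muG lam * alpha t ^ 2) (b := fun t => muG * beta t)
      (z := fun t => (4 * Γ11 + (4 * LH ^ 2 + 2 * lam) * (muF / muG) ^ 2 * Γ22) * alpha t ^ 2
          + 2 * (SH * (1 + Γ22)) ^ 2 / muF * (beta t ^ (2 + 2 * dH) / alpha t))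
      hVadp hVint (fun t ω => by positivity) (fun t => by positivity) (hα2sum.mul_left _)
      (fun t => (mul_pos hmuG (hbeta t)).le) ?_ (fun t => ?_)
      ((hα2sum.mul_left _).add (hβδsum.mul_left _)) fun t => ?_
    · rwa [summable_mul_left_iff hmuG.ne']
    · have := halpha t
      have := hbeta t
      positivity
    · exact sys.condExp_lyapunov_le (ℱ.le t) hlam hbalance hSH hdH htaylor hG (halpha t) (hbeta t)
        (h₁ t) (h₂ t) (h₃ t) (hx t) (hy t) (hL2 t).1 (hL2 t).2 (hξ t) (hψ t) (hξmean t) (hψmean t)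
        (hξ2 t) (hψ2 t) (hVint (t + 1)) fun ω => by simp only [hV, hxupd, hyupd]
  filter_upwards [hVlim] with ω hω
  refine ⟨tendsto_zero_of_mul_sq_norm_le one_pos hω fun t => ?_,
    tendsto_zero_of_mul_sq_norm_le hlam hω fun t => ?_⟩
  · have : 0 ≤ lam * ‖y t ω - ystar‖ ^ 2 := by positivity
    simp only [hV]; linarith
  · simp only [hV]; linarith [sq_nonneg ‖x t ω - H (y t ω)‖]

end Stochastic

section NaturalFiltration

variable {Ω : Type} [MeasurableSpace Ω] {dx dy : ℕ}
  {x0 : Ω → EuclideanSpace ℝ (Fin dx)} {y0 : Ω → EuclideanSpace ℝ (Fin dy)}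
  {ξ : ℕ → Ω → EuclideanSpace ℝ (Fin dx)} {ψ : ℕ → Ω → EuclideanSpace ℝ (Fin dy)}

theorem natFilt_mono : Monotone (natFilt x0 y0 ξ ψ) := fun _ _ hst =>
  sup_le_sup_left (biSup_mono fun _ h => Finset.range_mono hst h) _

theorem natFilt_le (hx0 : Measurable x0) (hy0 : Measurable y0) (hξ : ∀ t, Measurable (ξ t))
    (hψ : ∀ t, Measurable (ψ t)) (t : ℕ) : natFilt x0 y0 ξ ψ t ≤ ‹MeasurableSpace Ω› :=
  sup_le (sup_le hx0.comap_le hy0.comap_le)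
    (iSup₂_le fun s _ => sup_le (hξ s).comap_le (hψ s).comap_le)

theorem measurable_natFilt_fst (t : ℕ) : Measurable[natFilt x0 y0 ξ ψ t] x0 :=
  measurable_iff_comap_le.2 (le_sup_left.trans le_sup_left)

theorem measurable_natFilt_snd (t : ℕ) : Measurable[natFilt x0 y0 ξ ψ t] y0 :=
  measurable_iff_comap_le.2 (le_sup_right.trans le_sup_left)

theorem measurable_natFilt_noise (t : ℕ) :
    Measurable[natFilt x0 y0 ξ ψ (t + 1)] (ξ t) ∧ Measurable[natFilt x0 y0 ξ ψ (t + 1)] (ψ t) := by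
  have h : MeasurableSpace.comap (ξ t) inferInstance ⊔ MeasurableSpace.comap (ψ t) inferInstance ≤
      natFilt x0 y0 ξ ψ (t + 1) :=
    (le_iSup₂ (f := fun s (_ : s ∈ Finset.range (t + 1)) =>
      MeasurableSpace.comap (ξ s) inferInstance ⊔ MeasurableSpace.comap (ψ s) inferInstance) t
      (Finset.self_mem_range_succ t)).trans le_sup_right
  exact ⟨measurable_iff_comap_le.2 (le_sup_left.trans h),
    measurable_iff_comap_le.2 (le_sup_right.trans h)⟩

theorem measurable_natFilt_iterates
    {F : EuclideanSpace ℝ (Fin dx) → EuclideanSpace ℝ (Fin dy) → EuclideanSpace ℝ (Fin dx)}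
    {G : EuclideanSpace ℝ (Fin dx) → EuclideanSpace ℝ (Fin dy) → EuclideanSpace ℝ (Fin dy)}
    (hF : Measurable fun p : EuclideanSpace ℝ (Fin dx) × EuclideanSpace ℝ (Fin dy) => F p.1 p.2)
    (hG : Measurable fun p : EuclideanSpace ℝ (Fin dx) × EuclideanSpace ℝ (Fin dy) => G p.1 p.2)
    {alpha beta : ℕ → ℝ} {x : ℕ → Ω → EuclideanSpace ℝ (Fin dx)}
    {y : ℕ → Ω → EuclideanSpace ℝ (Fin dy)}
    (hxupd : ∀ t ω, x (t + 1) ω = x t ω - alpha t • (F (x t ω) (y t ω) + ξ t ω))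
    (hyupd : ∀ t ω, y (t + 1) ω = y t ω - beta t • (G (x t ω) (y t ω) + ψ t ω)) (t : ℕ) :
    Measurable[natFilt (x 0) (y 0) ξ ψ t] (x t) ∧ Measurable[natFilt (x 0) (y 0) ξ ψ t] (y t) := by
  induction t with
  | zero => exact ⟨measurable_natFilt_fst 0, measurable_natFilt_snd 0⟩
  | succ t ih =>
    have hx := ih.1.mono (natFilt_mono t.le_succ) le_rfl
    have hy := ih.2.mono (natFilt_mono t.le_succ) le_rfl
    obtain ⟨hξ, hψ⟩ := measurable_natFilt_noise (x0 := x 0) (y0 := y 0) (ξ := ξ) (ψ := ψ) t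
    rw [funext (hxupd t), funext (hyupd t)]
    exact ⟨hx.sub (((hF.comp (hx.prodMk hy)).add hξ).const_smul (alpha t)),
      hy.sub (((hG.comp (hx.prodMk hy)).add hψ).const_smul (beta t))⟩

end NaturalFiltration

/-- Almost sure convergence of nonlinear two-time-scale SA (Theorem E.3 (i)). -/
theorem almost_sure_convergence
    {Ω : Type} [MeasurableSpace Ω] (μ : Measure Ω) [IsProbabilityMeasure μ]
    {dx dy : ℕ}
    (F : EuclideanSpace ℝ (Fin dx) → EuclideanSpace ℝ (Fin dy) → EuclideanSpace ℝ (Fin dx))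
    (G : EuclideanSpace ℝ (Fin dx) → EuclideanSpace ℝ (Fin dy) → EuclideanSpace ℝ (Fin dy))
    (H : EuclideanSpace ℝ (Fin dy) → EuclideanSpace ℝ (Fin dx))
    (xstar : EuclideanSpace ℝ (Fin dx)) (ystar : EuclideanSpace ℝ (Fin dy))
    (hFroot : F xstar ystar = 0) (hGroot : G xstar ystar = 0)
    -- Assumption 1
    (LH LF : ℝ) (hLH : 0 ≤ LH) (hLF : 0 ≤ LF)
    (hFH : ∀ y, F (H y) y = 0)
    (hFHuniq : ∀ y x', F x' y = 0 → x' = H y)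
    (hHlip : ∀ y₁ y₂, ‖H y₁ - H y₂‖ ≤ LH * ‖y₁ - y₂‖)
    (hFlip : ∀ x' y, ‖F x' y - F (H y) y‖ ≤ LF * ‖x' - H y‖)
    -- Assumption 2
    (LGx LGy : ℝ) (hLGx : 0 ≤ LGx) (hLGy : 0 ≤ LGy)
    (hGlipx : ∀ x' y, ‖G x' y - G (H y) y‖ ≤ LGx * ‖x' - H y‖)
    (hGlipy : ∀ y, ‖G (H y) y - G (H ystar) ystar‖ ≤ LGy * ‖y - ystar‖)
    -- Assumption 3
    (muF muG : ℝ) (hmuF : 0 < muF) (hmuG : 0 < muG)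
    (hFmono : ∀ x' y, muF * ‖x' - H y‖ ^ 2 ≤ ⟪x' - H y, F x' y - F (H y) y⟫)
    (hGmono : ∀ y, muG * ‖y - ystar‖ ^ 2 ≤ ⟪y - ystar, G (H y) y - G (H ystar) ystar⟫)
    -- Assumption 4
    (H' : EuclideanSpace ℝ (Fin dy) → (EuclideanSpace ℝ (Fin dy) →L[ℝ] EuclideanSpace ℝ (Fin dx)))
    (hH' : ∀ y, HasFDerivAt H (H' y) y)
    (SH dH : ℝ) (hSH : 0 ≤ SH) (hdH : dH ∈ Set.Icc (0 : ℝ) 1)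
    (hHtaylor : ∀ y₁ y₂, ‖H y₁ - H y₂ - H' y₂ (y₁ - y₂)‖ ≤ SH * ‖y₁ - y₂‖ ^ (1 + dH))
    -- the two-time-scale stochastic approximation process
    (alpha beta : ℕ → ℝ) (halpha : ∀ t, 0 < alpha t) (hbeta : ∀ t, 0 < beta t)
    (ξ : ℕ → Ω → EuclideanSpace ℝ (Fin dx)) (ψ : ℕ → Ω → EuclideanSpace ℝ (Fin dy))
    (x : ℕ → Ω → EuclideanSpace ℝ (Fin dx)) (y : ℕ → Ω → EuclideanSpace ℝ (Fin dy))
    (hxupd : ∀ t ω, x (t + 1) ω = x t ω - alpha t • (F (x t ω) (y t ω) + ξ t ω))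
    (hyupd : ∀ t ω, y (t + 1) ω = y t ω - beta t • (G (x t ω) (y t ω) + ψ t ω))
    -- measurability
    (hFmeas : Measurable fun p : EuclideanSpace ℝ (Fin dx) × EuclideanSpace ℝ (Fin dy) => F p.1 p.2)
    (hGmeas : Measurable fun p : EuclideanSpace ℝ (Fin dx) × EuclideanSpace ℝ (Fin dy) => G p.1 p.2)
    (hx0meas : Measurable (x 0)) (hy0meas : Measurable (y 0))
    (hξmeas : ∀ t, Measurable (ξ t)) (hψmeas : ∀ t, Measurable (ψ t))
    -- finite initial second moments
    (hx0L2 : Integrable (fun ω => ‖x 0 ω‖ ^ 2) μ) (hy0L2 : Integrable (fun ω => ‖y 0 ω‖ ^ 2) μ)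
    -- noise assumption (martingale differences with bounded second conditional moments)
    (Γ11 Γ22 : ℝ) (hΓ11 : 0 ≤ Γ11) (hΓ22 : 0 ≤ Γ22)
    (hξmean : ∀ t, μ[ξ t | natFilt (x 0) (y 0) ξ ψ t] =ᵐ[μ] 0)
    (hψmean : ∀ t, μ[ψ t | natFilt (x 0) (y 0) ξ ψ t] =ᵐ[μ] 0)
    (hξ2int : ∀ t, Integrable (fun ω => ‖ξ t ω‖ ^ 2) μ)
    (hψ2int : ∀ t, Integrable (fun ω => ‖ψ t ω‖ ^ 2) μ)
    (hξ2 : ∀ t, ∀ᵐ ω ∂μ, (μ[fun ω' => ‖ξ t ω'‖ ^ 2 | natFilt (x 0) (y 0) ξ ψ t]) ω ≤ Γ11)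
    (hψ2 : ∀ t, ∀ᵐ ω ∂μ, (μ[fun ω' => ‖ψ t ω'‖ ^ 2 | natFilt (x 0) (y 0) ξ ψ t]) ω ≤ Γ22)
    -- appendix step-size assumption
    (hαub : ∀ t, alpha t ≤ muF / (4 * LF ^ 2))
    (hβub : ∀ t, beta t ≤ muG / LGy ^ 2)
    (hκub : ∀ t, beta t / alpha t ≤ min (muF * muG / (28 * LH * LGx * max 1 LGy)) (muF / muG))
    (hρub : ∀ t, beta t ^ 2 / alpha t ≤ muF / (16 * LH ^ 2 * LGx ^ 2))
    (hαgrow : ∀ t, alpha (t + 1) ≤ alpha t ∧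
      alpha t / alpha (t + 1) ≤ 1 + min (muF * alpha (t + 1) / 4) (muG * beta (t + 1) / 8))
    (hβgrow : ∀ t, beta (t + 1) ≤ beta t ∧ beta t / beta (t + 1) ≤ 1 + muG * beta (t + 1) / 32)
    -- summability conditions
    (hβdiv : ¬ Summable fun t => beta t)
    (hα2sum : Summable fun t => alpha t ^ 2)
    (hβδsum : Summable fun t => beta t ^ (2 + 2 * dH) / alpha t) :
    ∀ᵐ ω ∂μ,
      Tendsto (fun t => x t ω - H (y t ω)) atTop (nhds 0) ∧
      Tendsto (fun t => y t ω - ystar) atTop (nhds 0) := by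
  have hGstar : G (H ystar) ystar = 0 := by rw [← hFHuniq ystar xstar hFroot, hGroot]
  simp only [hFH, hGstar, sub_zero] at hFlip hGlipy hFmono hGmono
  let ℱ : Filtration ℕ _ :=
    { seq := natFilt (x 0) (y 0) ξ ψ
      mono' := natFilt_mono
      le' := natFilt_le hx0meas hy0meas hξmeas hψmeas }
  have hmeas := measurable_natFilt_iterates hFmeas hGmeas hxupd hyupd
  have hy0 : MemLp (fun ω => y 0 ω - ystar) 2 μ :=
    ((memLp_two_iff_integrable_sq_norm hy0meas.aestronglyMeasurable).2 hy0L2).sub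
      (memLp_const ystar)
  have hHcont : Continuous H := continuous_iff_continuousAt.2 fun y => (hH' y).continuousAt
  have hHy0 : MemLp (fun ω => H (y 0 ω) - H ystar) 2 μ :=
    hy0.of_le_mul ((hHcont.measurable.comp hy0meas).sub_const _).aestronglyMeasurable
      (ae_of_all _ fun ω => hHlip _ _)
  have hx0 : MemLp (fun ω => x 0 ω - H (y 0 ω)) 2 μ := by
    refine ((((memLp_two_iff_integrable_sq_norm hx0meas.aestronglyMeasurable).2 hx0L2).sub
      (memLp_const (H ystar))).sub hHy0).ae_eq (ae_of_all _ fun ω => ?_)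
    simp
  have hξL2 : ∀ t, MemLp (ξ t) 2 μ := fun t =>
    (memLp_two_iff_integrable_sq_norm (hξmeas t).aestronglyMeasurable).2 (hξ2int t)
  have hψL2 : ∀ t, MemLp (ψ t) 2 μ := fun t =>
    (memLp_two_iff_integrable_sq_norm (hψmeas t).aestronglyMeasurable).2 (hψ2int t)
  have htaylor : ∀ y₁ y₂,
      ‖H y₁ - H y₂ - fderiv ℝ H y₂ (y₁ - y₂)‖ ≤ SH * ‖y₁ - y₂‖ ^ (1 + dH) := fun y₁ y₂ => by
    rw [(hH' y₂).fderiv]; exact hHtaylor y₁ y₂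
  have h₃ : ∀ t, beta t ≤ muF / muG * alpha t := fun t =>
    (div_le_iff₀ (halpha t)).1 ((hκub t).trans (min_le_right _ _))
  rcases subsingleton_or_nontrivial (EuclideanSpace ℝ (Fin dy)) with hsub | hnon
  · have sys : IsTwoTimeScaleSystem F G H ystar LH LF 0 0 muF muG :=
      ⟨hLH, hmuF, hmuG, hHlip, hFlip, fun x' y => by simp [Subsingleton.elim (G x' y) (G (H y) y)],
        fun y => by simp [Subsingleton.elim (G (H y) y) 0], hFmono, hGmono⟩
    exact sys.ae_tendsto_zero (ℱ := ℱ) one_pos (by simp) hSH hdH htaylor hFmeas hGmeas halpha hbeta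
      (fun t => by simpa using (mul_pos hmuF (halpha t)).le)
      (fun t => by simpa using (mul_pos (mul_pos hmuF hmuG) (halpha t)).le) h₃ hβdiv hα2sum hβδsum
      hxupd hyupd (fun t => (hmeas t).1) (fun t => (hmeas t).2) hx0 hy0 hξL2 hψL2 hξmean hψmean
      hΓ11 hΓ22 hξ2 hψ2
  · have sys : IsTwoTimeScaleSystem F G H ystar LH LF LGx LGy muF muG :=
      ⟨hLH, hmuF, hmuG, hHlip, hFlip, hGlipx, hGlipy, hFmono, hGmono⟩
    have hmuGLGy : muG ≤ LGy := by
      obtain ⟨y, hy⟩ := exists_ne ystar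
      have hpos : 0 < ‖y - ystar‖ := norm_pos_iff.2 (sub_ne_zero.2 hy)
      have h := (hGmono y).trans ((real_inner_le_norm _ _).trans
        (mul_le_mul_of_nonneg_left (hGlipy y) (norm_nonneg _)))
      exact le_of_mul_le_mul_right (by linarith) (pow_pos hpos 2)
    have hκ : ∀ t, beta t / alpha t ≤ muF * muG / (28 * LH * LGx * max 1 LGy) := fun t =>
      (hκub t).trans (min_le_left _ _)
    have hden : 28 * LH * LGx * max 1 LGy ≠ 0 := fun h => by
      have := (div_pos (hbeta 0) (halpha 0)).trans_le (hκ 0)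
      simp [h] at this
    have hLHpos : 0 < LH := hLH.lt_of_ne fun h => hden (by simp [← h])
    have hLGxpos : 0 < LGx := hLGx.lt_of_ne fun h => hden (by simp [← h])
    have hLGypos : 0 < LGy := hmuG.trans_le hmuGLGy
    have hrate : ∀ t, 28 * (LH * LGx) * beta t * max 1 LGy ≤ muF * muG * alpha t := fun t => by
      have h := hκ t
      rw [div_le_div_iff₀ (halpha t) (by positivity)] at h
      linarith
    refine sys.ae_tendsto_zero (ℱ := ℱ) (lam := LH * LGy / LGx) (by positivity) (by field_simp)
      hSH hdH htaylor hFmeas hGmeas halpha hbeta (fun t => ?_) (fun t => ?_) h₃ hβdiv hα2sum hβδsum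
      hxupd hyupd (fun t => (hmeas t).1) (fun t => (hmeas t).2) hx0 hy0 hξL2 hψL2 hξmean hψmean
      hΓ11 hΓ22 hξ2 hψ2
    all_goals have hβ : 0 ≤ 28 * (LH * LGx) * beta t := by have := hbeta t; positivity
    · have h := mul_le_mul_of_nonneg_left (hmuGLGy.trans (le_max_right 1 LGy)) hβ
      exact le_of_mul_le_mul_right (by linarith [hrate t]) hmuG
    · have h := mul_le_mul_of_nonneg_left (le_max_right 1 LGy) hβ
      linarith [hrate t]
end
end

section
/- Let H : ℝ^{d_y} → ℝ^{d_x} be differentiable and suppose there are constants S ≥ 0 and δ ∈ [0,1] such that ‖H(y₁) − H(y₂) − ∇H(y₂)(y₁ − y₂)‖ ≤ S‖y₁ − y₂‖^{1+δ} for all y₁, y₂. Then for all y₁, y₂: ‖∇H(y₁) − ∇H(y₂)‖ ≤ 2^{1−δ}·√(1+δ)·((1+δ)/δ)^{δ/2}·S·‖y₁ − y₂‖^δ, where by convention ((1+δ)/δ)^{δ/2} = 1 when δ = 0. -/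
set_option autoImplicit false

open scoped RealInnerProductSpace

section TaylorBound

variable {E F : Type*} [NormedAddCommGroup E] [InnerProductSpace ℝ E]
  [NormedAddCommGroup F] [NormedSpace ℝ F]

/-- A concavity bound for powers of the two diagonals of a parallelogram. -/
theorem norm_add_rpow_add_norm_sub_rpow_le {δ : ℝ} (h0 : 0 ≤ δ) (h1 : δ ≤ 1) (v e : E) :
    ‖v + e‖ ^ (1 + δ) + ‖v - e‖ ^ (1 + δ) ≤
      2 * (‖v‖ ^ 2 + ‖e‖ ^ 2) ^ ((1 + δ) / 2) := by
  have hpow (x : E) : ‖x‖ ^ (1 + δ) = (‖x‖ ^ 2) ^ ((1 + δ) / 2) := by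
    rw [← Real.rpow_natCast_mul (norm_nonneg x)]
    congr 1
    push_cast
    ring
  have hconc := (Real.concaveOn_rpow (p := (1 + δ) / 2) (by linarith) (by linarith)).2
    (Set.mem_Ici.2 (sq_nonneg ‖v + e‖)) (Set.mem_Ici.2 (sq_nonneg ‖v - e‖))
    (by norm_num : (0 : ℝ) ≤ 1 / 2) (by norm_num : (0 : ℝ) ≤ 1 / 2) (by norm_num)
  have hpar := parallelogram_law_with_norm ℝ v e
  have hmean : (1 / 2 : ℝ) • ‖v + e‖ ^ 2 + (1 / 2 : ℝ) • ‖v - e‖ ^ 2 = ‖v‖ ^ 2 + ‖e‖ ^ 2 := by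
    simp only [smul_eq_mul]
    linarith
  rw [hmean] at hconc
  simp only [smul_eq_mul] at hconc
  rw [hpow, hpow]
  linarith

/-- A uniform first-order Taylor bound controls the derivative difference at the endpoints of the
segment with midpoint `m` and half-length vector `e`. -/
theorem norm_deriv_sub_apply_le_of_taylor_bound {H : E → F} {H' : E → E →L[ℝ] F} {S δ : ℝ}
    (hS : 0 ≤ S) (h0 : 0 ≤ δ) (h1 : δ ≤ 1)
    (hTaylor : ∀ y₁ y₂, ‖H y₁ - H y₂ - H' y₂ (y₁ - y₂)‖ ≤ S * ‖y₁ - y₂‖ ^ (1 + δ))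
    (m e v : E) :
    ‖(H' (m + e) - H' (m - e)) v‖ ≤ 2 * S * (‖v‖ ^ 2 + ‖e‖ ^ 2) ^ ((1 + δ) / 2) := by
  have t1 := hTaylor (m + v) (m - e)
  have t2 := hTaylor (m + v) (m + e)
  have t3 := hTaylor (m - v) (m - e)
  have t4 := hTaylor (m - v) (m + e)
  rw [show m + v - (m - e) = v + e by abel] at t1
  rw [show m + v - (m + e) = v - e by abel] at t2
  rw [show m - v - (m - e) = -(v - e) by abel, norm_neg] at t3
  rw [show m - v - (m + e) = -(v + e) by abel, norm_neg] at t4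
  have hsum : (2 : ℝ) • (H' (m + e) - H' (m - e)) v =
      (H (m + v) - H (m - e) - H' (m - e) (v + e))
        - (H (m + v) - H (m + e) - H' (m + e) (v - e))
        - ((H (m - v) - H (m - e) - H' (m - e) (-(v - e)))
          - (H (m - v) - H (m + e) - H' (m + e) (-(v + e)))) := by
    simp only [sub_apply, map_add, map_sub, map_neg]
    module
  have hnorm := norm_smul (2 : ℝ) ((H' (m + e) - H' (m - e)) v)
  rw [hsum, Real.norm_two] at hnorm
  have hle := (norm_sub_le _ _).trans (add_le_add (norm_sub_le _ _) (norm_sub_le _ _)) |>.trans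
    (add_le_add (add_le_add t1 t2) (add_le_add t3 t4))
  rw [hnorm] at hle
  have hpar := mul_le_mul_of_nonneg_left (norm_add_rpow_add_norm_sub_rpow_le h0 h1 v e) hS
  linarith

/-- The radius `D / (2 * √δ)` turns the parallelogram bound into the Hölder constant. -/
theorem rpow_sq_add_sq_half_eq {δ D : ℝ} (hδ : 0 < δ) (hD : 0 < D) :
    2 * ((D / (2 * √δ)) ^ 2 + (D / 2) ^ 2) ^ ((1 + δ) / 2) =
      2 ^ (1 - δ) * √(1 + δ) * ((1 + δ) / δ) ^ (δ / 2) * D ^ δ * (D / (2 * √δ)) := by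
  have hsq : √δ ^ 2 = δ := Real.sq_sqrt hδ.le
  have hbase : (D / (2 * √δ)) ^ 2 + (D / 2) ^ 2 = (D / 2) ^ 2 * ((1 + δ) / δ) := by
    rw [div_pow, mul_pow, hsq]
    field_simp
  have hq : 0 < (1 + δ) / δ := by positivity
  rw [hbase, Real.mul_rpow (by positivity) hq.le, ← Real.rpow_natCast_mul (by positivity),
    show ((2 : ℕ) : ℝ) * ((1 + δ) / 2) = 1 + δ by push_cast; ring,
    show (1 + δ) / 2 = 1 / 2 + δ / 2 by ring, Real.rpow_add hq, ← Real.sqrt_eq_rpow,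
    Real.sqrt_div (by positivity), Real.rpow_add (by positivity), Real.rpow_one,
    Real.div_rpow hD.le (by norm_num), Real.rpow_sub (by norm_num), Real.rpow_one]
  field_simp

/-- A uniform first-order Taylor bound of order `1 + δ` makes the derivative `δ`-Hölder. -/
theorem norm_deriv_sub_le_of_taylor_bound {H : E → F} {H' : E → E →L[ℝ] F} {S δ : ℝ}
    (hS : 0 ≤ S) (h0 : 0 ≤ δ) (h1 : δ ≤ 1)
    (hTaylor : ∀ y₁ y₂, ‖H y₁ - H y₂ - H' y₂ (y₁ - y₂)‖ ≤ S * ‖y₁ - y₂‖ ^ (1 + δ))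
    (y₁ y₂ : E) :
    ‖H' y₁ - H' y₂‖ ≤
      2 ^ (1 - δ) * √(1 + δ) * ((1 + δ) / δ) ^ (δ / 2) * S * ‖y₁ - y₂‖ ^ δ := by
  have hC : 0 ≤ 2 ^ (1 - δ) * √(1 + δ) * ((1 + δ) / δ) ^ (δ / 2) * S * ‖y₁ - y₂‖ ^ δ := by
    positivity
  rcases eq_or_ne y₁ y₂ with rfl | hne
  · simpa using hC
  have hD : 0 < ‖y₁ - y₂‖ := norm_pos_iff.2 (sub_ne_zero.2 hne)
  have hscale (u : E) (hu : ‖u‖ = 1) (r : ℝ) (hr : 0 < r) :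
      r * ‖(H' y₁ - H' y₂) u‖ ≤
        2 * S * (r ^ 2 + (‖y₁ - y₂‖ / 2) ^ 2) ^ ((1 + δ) / 2) := by
    have h := norm_deriv_sub_apply_le_of_taylor_bound hS h0 h1 hTaylor
      ((1 / 2 : ℝ) • (y₁ + y₂)) ((1 / 2 : ℝ) • (y₁ - y₂)) (r • u)
    rw [show (1 / 2 : ℝ) • (y₁ + y₂) + (1 / 2 : ℝ) • (y₁ - y₂) = y₁ by module,
      show (1 / 2 : ℝ) • (y₁ + y₂) - (1 / 2 : ℝ) • (y₁ - y₂) = y₂ by module,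
      map_smul, norm_smul, norm_smul, norm_smul, hu, mul_one, Real.norm_of_nonneg hr.le,
      Real.norm_of_nonneg (by norm_num : (0 : ℝ) ≤ 1 / 2)] at h
    rwa [div_eq_inv_mul, ← one_div]
  refine ContinuousLinearMap.opNorm_le_of_unit_norm hC fun u hu ↦ ?_
  rcases h0.eq_or_lt with rfl | hδ
  · have hlin (r : ℝ) (hr : 0 < r) :
        r * ‖(H' y₁ - H' y₂) u‖ ≤ 2 * S * (r + ‖y₁ - y₂‖ / 2) := by
      refine (hscale u hu r hr).trans (mul_le_mul_of_nonneg_left ?_ (by positivity))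
      rw [add_zero, ← Real.sqrt_eq_rpow]
      exact Real.sqrt_le_iff.2 ⟨by positivity, by nlinarith [mul_pos hr hD]⟩
    suffices ‖(H' y₁ - H' y₂) u‖ ≤ 2 * S by simpa using this
    by_contra! hlt
    have hgap : 0 < ‖(H' y₁ - H' y₂) u‖ - 2 * S := sub_pos.2 hlt
    have h := hlin ((S * ‖y₁ - y₂‖ + 1) / (‖(H' y₁ - H' y₂) u‖ - 2 * S)) (by positivity)
    have hcancel := div_mul_cancel₀ (S * ‖y₁ - y₂‖ + 1) hgap.ne'
    linarith
  · have hr : 0 < ‖y₁ - y₂‖ / (2 * √δ) := by positivity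
    refine le_of_mul_le_mul_left ((hscale u hu _ hr).trans_eq ?_) hr
    rw [mul_right_comm, rpow_sq_add_sq_half_eq hδ hD]
    ring

end TaylorBound

/-- The uniform local linearity bound implies Hölder continuity of the derivative
(the other direction of Proposition B.1). -/
theorem holder_deriv_of_taylor_bound {dx dy : ℕ}
    (H : EuclideanSpace ℝ (Fin dy) → EuclideanSpace ℝ (Fin dx))
    (H' : EuclideanSpace ℝ (Fin dy) → (EuclideanSpace ℝ (Fin dy) →L[ℝ] EuclideanSpace ℝ (Fin dx)))
    (hH' : ∀ y, HasFDerivAt H (H' y) y)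
    (S δ : ℝ) (hS : 0 ≤ S) (hδ : δ ∈ Set.Icc (0 : ℝ) 1)
    (hTaylor : ∀ y₁ y₂, ‖H y₁ - H y₂ - H' y₂ (y₁ - y₂)‖ ≤ S * ‖y₁ - y₂‖ ^ (1 + δ)) :
    ∀ y₁ y₂, ‖H' y₁ - H' y₂‖ ≤
      2 ^ (1 - δ) * Real.sqrt (1 + δ) * ((1 + δ) / δ) ^ (δ / 2) * S * ‖y₁ - y₂‖ ^ δ := by
  exact norm_deriv_sub_le_of_taylor_bound hS hδ.1 hδ.2 hTaylor
end
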